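/- arXiv:1604.06996 — 2 statements merged into one kernel-verified Lean document; each statement's English description precedes it below -/
import Mathlib

section
/- Let (H|S) be a parity check system over R whose associated code C contains at least two elements, and set S^diff = {S_col(l) − S_col(k) : 1 ≤ k < l ≤ s} ∪ {(0,…,0)^T}. Then the minimum distance of C satisfies d(C) = min{wt(x) : x ∈ R^n, x ≠ 0, Hx^T ∈ S^diff}. -/
open scoped BigOperators

/-- Dot product on `Fin n → R`. -/
def dotP {R : Type*} [CommRing R] {n : ℕ} (x y : Fin n → R) : R := ∑ i, x i * y i

/-- The orthogonal (dual) of a subset of `Fin n → R`, as a submodule. -/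
def perp {R : Type*} [CommRing R] {n : ℕ} (B : Set (Fin n → R)) :
    Submodule R (Fin n → R) where
  carrier := {y | ∀ x ∈ B, dotP x y = 0}
  add_mem' := by
    intro y z hy hz x hx
    have h1 := hy x hx
    have h2 := hz x hx
    simp only [dotP, Set.mem_setOf_eq, Pi.add_apply, mul_add, Finset.sum_add_distrib] at *
    rw [h1, h2, add_zero]
  zero_mem' := by
    intro x hx
    simp [dotP]
  smul_mem' := by
    intro c y hy x hx
    have h1 := hy x hx
    simp only [dotP, Set.mem_setOf_eq] at *
    have h2 : ∑ i, x i * (c • y) i = c * ∑ i, x i * y i := by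
      rw [Finset.mul_sum]
      refine Finset.sum_congr rfl fun i _ => ?_
      simp only [Pi.smul_apply, smul_eq_mul]
      ring
    rw [h2, h1, mul_zero]

/-- The Frobenius property of a finite commutative ring: for every submodule `D` of `R^k`,
`D^⊥⊥ = D` and `|D| ⬝ |D^⊥| = |R|^k`. -/
def FrobeniusProperty (R : Type*) [CommRing R] : Prop :=
  ∀ (k : ℕ) (D : Submodule R (Fin k → R)),
    perp ((perp (D : Set (Fin k → R)) : Submodule R (Fin k → R)) : Set (Fin k → R)) = D ∧
    Nat.card D * Nat.card (perp (D : Set (Fin k → R))) = Nat.card R ^ k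

/-- `ε` is a generating additive character of `R`. -/
def IsGenChar (R : Type*) [CommRing R] (ε : R → ℂ) : Prop :=
  (∀ a b, ε (a + b) = ε a * ε b) ∧ ε 0 = 1 ∧ (∀ x, ε x ≠ 0) ∧
  ∀ χ : R → ℂ, (∀ a b, χ (a + b) = χ a * χ b) → (∀ x, χ x ≠ 0) →
    ∃ r : R, ∀ x, χ x = ε (r * x)

/-- A parity check system `(H|S)` over `R`. -/
def IsPCS {R : Type*} [CommRing R] {m n s : ℕ} (H : Matrix (Fin m) (Fin n) R)
    (S : Matrix (Fin m) (Fin s) R) : Prop :=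
  (∀ i j, ∃ x : Fin n → R, dotP (H i) x = S i j) ∧
  (∀ j j' : Fin s, (∀ i, S i j = S i j') → j = j') ∧
  (∀ r r' : Fin m → R, ∑ i, r i • H i = ∑ i, r' i • H i →
    ∑ i, r i • S i = ∑ i, r' i • S i)

/-- The code associated with a parity check system `(H|S)`. -/
def codeOf {R : Type*} [CommRing R] {m n s : ℕ} (H : Matrix (Fin m) (Fin n) R)
    (S : Matrix (Fin m) (Fin s) R) : Set (Fin n → R) :=
  {x | ∃ j : Fin s, H.mulVec x = fun i => S i j}

/-- The minimum (Hamming) distance of a code. -/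
noncomputable def minDist {R : Type*} [CommRing R] [DecidableEq R] {n : ℕ} (C : Set (Fin n → R)) : ℕ :=
  sInf {d | ∃ c ∈ C, ∃ c' ∈ C, c ≠ c' ∧ hammingDist c c' = d}

/-- Over a ring with the Frobenius property, every column of `S` lies in the image of `H`. -/
theorem IsPCS.exists_mulVec_eq {R : Type*} [CommRing R] {m n s : ℕ}
    (hFrob : FrobeniusProperty R) {H : Matrix (Fin m) (Fin n) R} {S : Matrix (Fin m) (Fin s) R}
    (hPCS : IsPCS H S) (j : Fin s) : ∃ x : Fin n → R, H.mulVec x = fun i => S i j := by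
  let K : Submodule R (Fin m → R) := LinearMap.range H.mulVecLin
  suffices h : (fun i => S i j) ∈ K by
    obtain ⟨x, hx⟩ := h
    exact ⟨x, by simpa using hx⟩
  rw [← (hFrob m K).1]
  intro r hr
  have hH : ∑ i, r i • H i = 0 := by
    funext t
    have h1 : dotP (H.mulVec (Pi.single t 1)) r = 0 :=
      hr _ ⟨Pi.single t 1, by simp⟩
    simpa [dotP, mul_comm] using h1
  have h2 := hPCS.2.2 r 0 (by simpa using hH)
  simpa [dotP] using congrFun h2 j

/-- the minimum distance of the code associated with a parity check system
`(H|S)` equals the minimum weight of a nonzero `x` with `Hxᵀ ∈ S^diff`. -/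
theorem minDist_eq_pcs {R : Type*} [CommRing R] [Fintype R] [DecidableEq R]
    {m n s : ℕ} (hFrob : FrobeniusProperty R)
    (H : Matrix (Fin m) (Fin n) R) (S : Matrix (Fin m) (Fin s) R)
    (hPCS : IsPCS H S)
    (htwo : ∃ c ∈ codeOf H S, ∃ c' ∈ codeOf H S, c ≠ c')
    (Sdiff : Set (Fin m → R))
    (hSdiff : Sdiff = {v : Fin m → R | ∃ k l : Fin s, k < l ∧
        v = (fun i => S i l) - fun i => S i k} ∪ {0}) :
    minDist (codeOf H S) =
      sInf {w : ℕ | ∃ x : Fin n → R, x ≠ 0 ∧ H.mulVec x ∈ Sdiff ∧ hammingNorm x = w} := by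
  subst hSdiff
  unfold minDist
  congr 1
  ext d
  constructor
  · rintro ⟨c, ⟨j, hj⟩, c', ⟨j', hj'⟩, hne, rfl⟩
    rcases lt_trichotomy j j' with h | rfl | h
    · refine ⟨c' - c, sub_ne_zero.2 hne.symm, Or.inl ⟨j, j', h, ?_⟩, ?_⟩
      · rw [Matrix.mulVec_sub, hj, hj']
      · rw [hammingDist_eq_hammingNorm, neg_add_eq_sub]
    · refine ⟨c - c', sub_ne_zero.2 hne, Or.inr ?_, by
        rw [hammingDist_comm, hammingDist_eq_hammingNorm, neg_add_eq_sub]⟩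
      rw [Matrix.mulVec_sub, hj, hj', sub_self]
      rfl
    · refine ⟨c - c', sub_ne_zero.2 hne, Or.inl ⟨j', j, h, ?_⟩, by
        rw [hammingDist_comm, hammingDist_eq_hammingNorm, neg_add_eq_sub]⟩
      rw [Matrix.mulVec_sub, hj, hj']
  · rintro ⟨x, hx, hmem, rfl⟩
    suffices h : ∃ c ∈ codeOf H S, x + c ∈ codeOf H S by
      obtain ⟨c, hc, hxc⟩ := h
      exact ⟨x + c, hxc, c, hc, by simpa using hx, by
        rw [hammingDist_comm, hammingDist_eq_hammingNorm, neg_add_eq_sub, add_sub_cancel_right]⟩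
    rcases hmem with ⟨k, l, -, hkl⟩ | h0
    · obtain ⟨c, hc⟩ := hPCS.exists_mulVec_eq hFrob k
      exact ⟨c, ⟨k, hc⟩, l, by rw [Matrix.mulVec_add, hkl, hc, sub_add_cancel]⟩
    · obtain ⟨c, ⟨j, hj⟩, -⟩ := htwo
      exact ⟨c, ⟨j, hj⟩, j, by rw [Matrix.mulVec_add, Set.mem_singleton_iff.1 h0, zero_add, hj]⟩
end

section
/- Let D be a submodule of R^n and let x ∈ R^n. Then Σ_{d∈D} ε(x·d) = |D| if x ∈ D^⊥, and Σ_{d∈D} ε(x·d) = 0 if x ∉ D^⊥. -/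
open scoped BigOperators

/-- A generating character takes a value other than `1` on every nonzero principal ideal. -/
lemma IsGenChar.exists_mul_ne_one {R : Type*} [CommRing R] [Finite R] {ε : R → ℂ}
    (hε : IsGenChar R ε) {a : R} (ha : a ≠ 0) : ∃ r, ε (r * a) ≠ 1 := by
  obtain ⟨ψ, hψ⟩ := AddChar.exists_apply_ne_zero.2 ha
  obtain ⟨r, hr⟩ := hε.2.2.2 ψ ψ.map_add_eq_mul fun x => (ψ.val_isUnit x).ne_zero
  exact ⟨r, hr a ▸ hψ⟩

lemma dotP_comm {R : Type*} [CommRing R] {n : ℕ} (x y : Fin n → R) : dotP x y = dotP y x :=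
  dotProduct_comm x y

/-- The character `d ↦ ε (x · d)` of a submodule `D`. -/
def IsGenChar.dotChar {R : Type*} [CommRing R] {ε : R → ℂ} (hε : IsGenChar R ε) {n : ℕ}
    (D : Submodule R (Fin n → R)) (x : Fin n → R) : AddChar D ℂ where
  toFun d := ε (dotP x d)
  map_zero_eq_one' := (congrArg ε (dotProduct_zero x)).trans hε.2.1
  map_add_eq_mul' d e := (congrArg ε (dotProduct_add x d e)).trans (hε.1 _ _)

lemma IsGenChar.dotChar_eq_zero_iff {R : Type*} [CommRing R] [Finite R] {ε : R → ℂ}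
    (hε : IsGenChar R ε) {n : ℕ} (D : Submodule R (Fin n → R)) (x : Fin n → R) :
    hε.dotChar D x = 0 ↔ x ∈ perp (D : Set (Fin n → R)) := by
  constructor
  · intro h d hd
    by_contra hne
    obtain ⟨r, hr⟩ := hε.exists_mul_ne_one hne
    have h1 : ε (dotP x (r • d)) = 1 :=
      DFunLike.congr_fun h (⟨r • d, D.smul_mem r hd⟩ : D)
    have h2 : dotP x (r • d) = r * dotP d x :=
      (dotProduct_smul r x d).trans (congrArg (r * ·) (dotP_comm x d))
    exact hr (h2 ▸ h1)
  · intro h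
    ext d
    change ε (dotP x d) = 1
    rw [dotP_comm, h d d.2, hε.2.1]

/-- character-sum orthogonality: `Σ_{d ∈ D} ε(x·d)` equals `|D|` if
`x ∈ D^⊥` and `0` otherwise. -/
theorem char_sum_orthogonality {R : Type*} [CommRing R] [Fintype R] [DecidableEq R]
    {n : ℕ} (hFrob : FrobeniusProperty R)
    (ε : R → ℂ) (hε : IsGenChar R ε)
    (D : Submodule R (Fin n → R)) (x : Fin n → R) :
    (x ∈ perp (D : Set (Fin n → R)) →
      ∑ᶠ d ∈ (D : Set (Fin n → R)), ε (dotP x d) = (Nat.card D : ℂ)) ∧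
    (x ∉ perp (D : Set (Fin n → R)) →
      ∑ᶠ d ∈ (D : Set (Fin n → R)), ε (dotP x d) = 0) := by
  classical
  have := Fintype.ofFinite D
  have hsum : ∑ᶠ d ∈ (D : Set (Fin n → R)), ε (dotP x d) = ∑ d, hε.dotChar D x d := by
    rw [← finsum_set_coe_eq_finsum_mem]
    exact finsum_eq_sum_of_fintype _
  rw [hsum, AddChar.sum_eq_ite, ← hε.dotChar_eq_zero_iff, Nat.card_eq_fintype_card]
  exact ⟨fun h => if_pos h, fun h => if_neg h⟩
end
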